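/- Let H ∈ A, A' := A \ {H}, and let θ ∈ D(A') be homogeneous of degree d := |A'| − |A^H| with θ ∉ D(A). Then for every φ ∈ D(A') there exists f ∈ S such that φ − f θ ∈ D(A). -/

import Mathlib

open MvPolynomial

noncomputable section

attribute [local instance] Classical.propDecidable

namespace ArrPOG

variable (K : Type) [Field K] (ℓ : ℕ)

/-- A polynomial vector field on `K^ℓ`: `θ = Σ θᵢ ∂/∂xᵢ`, identified with its
coefficient vector `(θ₁,…,θ_ℓ)` in `S = K[x₁,…,x_ℓ]`. -/
abbrev Deriv : Type := Fin ℓ → MvPolynomial (Fin ℓ) K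

variable {K ℓ}

/-- The linear polynomial `α_H ∈ S` associated to a linear form `φ ∈ V*`. -/
def linPoly (φ : Module.Dual K (Fin ℓ → K)) : MvPolynomial (Fin ℓ) K :=
  ∑ i, MvPolynomial.C (φ (Pi.single i 1)) * MvPolynomial.X i

/-- `θ(α)` for a derivation `θ` and the linear form `α` given by `φ ∈ V*`. -/
def applyLin (θ : Deriv K ℓ) (φ : Module.Dual K (Fin ℓ → K)) : MvPolynomial (Fin ℓ) K :=
  ∑ i, MvPolynomial.C (φ (Pi.single i 1)) * θ i

/-- An arrangement: a finite set of hyperplanes (kernels of nonzero linear forms). -/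
def IsArrangement (A : Finset (Submodule K (Fin ℓ → K))) : Prop :=
  ∀ H ∈ A, ∃ φ : Module.Dual K (Fin ℓ → K), φ ≠ 0 ∧ LinearMap.ker φ = H

/-- Essential: the common intersection of all members is `0`. -/
def Essential (A : Finset (Submodule K (Fin ℓ → K))) : Prop :=
  A.inf id = ⊥

/-- Membership in the logarithmic derivation module `D(A)`:
`θ(α_H) ∈ S·α_H` for every `H ∈ A`. -/
def InD (A : Finset (Submodule K (Fin ℓ → K))) (θ : Deriv K ℓ) : Prop :=
  ∀ H ∈ A, ∀ φ : Module.Dual K (Fin ℓ → K), LinearMap.ker φ = H → linPoly φ ∣ applyLin θ φ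

/-- A derivation is homogeneous of degree `n` if all its coefficients are. -/
def HomogDeriv (θ : Deriv K ℓ) (n : ℕ) : Prop := ∀ i, (θ i).IsHomogeneous n

/-- `θ₁,…,θₙ` generate `D(A)` as an `S`-module. -/
def GeneratesD {n : ℕ} (A : Finset (Submodule K (Fin ℓ → K))) (θ : Fin n → Deriv K ℓ) : Prop :=
  (∀ i, InD A (θ i)) ∧
    ∀ η, InD A η → ∃ c : Fin n → MvPolynomial (Fin ℓ) K, η = ∑ i, c i • θ i

/-- `S`-linear independence of a family of derivations. -/
def IndepD {n : ℕ} (θ : Fin n → Deriv K ℓ) : Prop :=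
  ∀ c : Fin n → MvPolynomial (Fin ℓ) K, (∑ i, c i • θ i) = 0 → ∀ i, c i = 0

/-- `A` is free with exponents `e`: `D(A)` has a homogeneous basis of degrees `e i`. -/
def IsFreeExp (A : Finset (Submodule K (Fin ℓ → K))) (e : Fin ℓ → ℕ) : Prop :=
  ∃ θ : Fin ℓ → Deriv K ℓ, (∀ i, HomogDeriv (θ i) (e i)) ∧ GeneratesD A θ ∧ IndepD θ

/-- `A` is free. -/
def IsFree (A : Finset (Submodule K (Fin ℓ → K))) : Prop := ∃ e, IsFreeExp A e

/-- `A` is plus-one generated with exponents `e`, level `lev`, realized by the minimal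
homogeneous generators `θ₁,…,θ_ℓ, φ` whose unique syzygy is `Σ fᵢ•θᵢ + α•φ = 0`:
this encodes the minimal free resolution
`0 → S[-lev-1] → S[-lev] ⊕ (⊕ S[-eᵢ]) → D(A) → 0`. -/
def IsPOGWith (A : Finset (Submodule K (Fin ℓ → K))) (e : Fin ℓ → ℕ) (lev : ℕ)
    (θ : Fin ℓ → Deriv K ℓ) (φ : Deriv K ℓ)
    (f : Fin ℓ → MvPolynomial (Fin ℓ) K) (α : MvPolynomial (Fin ℓ) K) : Prop :=
  (∀ i, InD A (θ i)) ∧ InD A φ ∧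
  (∀ i, HomogDeriv (θ i) (e i)) ∧ HomogDeriv φ lev ∧
  (∀ η, InD A η → ∃ (c : Fin ℓ → MvPolynomial (Fin ℓ) K) (g : MvPolynomial (Fin ℓ) K),
      η = (∑ i, c i • θ i) + g • φ) ∧
  α.IsHomogeneous 1 ∧
  (∀ i, (f i).IsHomogeneous (lev + 1 - e i)) ∧
  (∀ i, MvPolynomial.constantCoeff (f i) = 0) ∧
  ((∑ i, f i • θ i) + α • φ = 0) ∧
  (¬ (α = 0 ∧ ∀ i, f i = 0)) ∧
  (∀ (g : Fin ℓ → MvPolynomial (Fin ℓ) K) (h : MvPolynomial (Fin ℓ) K),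
      ((∑ i, g i • θ i) + h • φ = 0) →
      ∃ q : MvPolynomial (Fin ℓ) K, (∀ i, g i = q * f i) ∧ h = q * α)

/-- Plus-one generated with exponents `e` and level `lev`. -/
def IsPOG (A : Finset (Submodule K (Fin ℓ → K))) (e : Fin ℓ → ℕ) (lev : ℕ) : Prop :=
  ∃ θ φ f α, IsPOGWith A e lev θ φ f α

/-- Strictly plus-one generated: the level coefficient `α` is nonzero. -/
def IsSPOG (A : Finset (Submodule K (Fin ℓ → K))) (e : Fin ℓ → ℕ) (lev : ℕ) : Prop :=
  ∃ θ φ f α, IsPOGWith A e lev θ φ f α ∧ α ≠ 0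

/-- The restriction `A^H = {L ⊓ H | L ∈ A \ {H}}`. -/
def restrict (A : Finset (Submodule K (Fin ℓ → K))) (H : Submodule K (Fin ℓ → K)) :
    Finset (Submodule K (Fin ℓ → K)) :=
  (A.erase H).image (fun L => L ⊓ H)

/-- The localization `A_X = {L ∈ A | X ⊆ L}`. -/
def localize (A : Finset (Submodule K (Fin ℓ → K))) (X : Submodule K (Fin ℓ → K)) :
    Finset (Submodule K (Fin ℓ → K)) :=
  A.filter (fun L => X ≤ L)

/-- The intersection lattice of `A`, inside the ambient space `T`. -/
def latticeOf (T : Submodule K (Fin ℓ → K)) (A : Finset (Submodule K (Fin ℓ → K))) :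
    Finset (Submodule K (Fin ℓ → K)) :=
  A.powerset.image (fun B => T ⊓ B.inf id)

/-- The Möbius function of the poset `L` (intersection lattice with top `T`). -/
def mob (T : Submodule K (Fin ℓ → K)) (L : Finset (Submodule K (Fin ℓ → K)))
    (X : Submodule K (Fin ℓ → K)) : ℤ :=
  if X = T then 1
  else - ∑ Y ∈ (L.filter fun Z => X < Z).attach, mob T L Y.1
termination_by (L.filter fun Z => X < Z).card
decreasing_by
  obtain ⟨Y, hY⟩ := Y
  simp only [Finset.mem_filter] at hY
  apply Finset.card_lt_card
  rw [Finset.ssubset_def]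
  constructor
  · intro Z hZ
    simp only [Finset.mem_filter] at hZ ⊢
    exact ⟨hZ.1, lt_trans hY.2 hZ.2⟩
  · intro hsub
    have h2 := hsub (Finset.mem_filter.mpr ⟨hY.1, hY.2⟩)
    simp only [Finset.mem_filter] at h2
    exact lt_irrefl Y h2.2

/-- The characteristic polynomial `χ(A;t) = Σ_{X ∈ L(A)} μ(X) t^{dim X}`
of an arrangement inside the ambient space `T`. -/
def charPoly (T : Submodule K (Fin ℓ → K)) (A : Finset (Submodule K (Fin ℓ → K))) :
    Polynomial ℤ :=
  ∑ X ∈ latticeOf T A,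
    Polynomial.C (mob T (latticeOf T A) X) * Polynomial.X ^ (Module.finrank K X)

/-- The Betti number `b_i(A)`: `χ(A;t) = Σ (-1)^i b_i(A) t^{ℓ-i}`. -/
def bNum (A : Finset (Submodule K (Fin ℓ → K))) (i : ℕ) : ℤ :=
  (-1) ^ i * (charPoly (⊤ : Submodule K (Fin ℓ → K)) A).coeff (ℓ - i)

/-- Evaluation of the Poincaré polynomial `π(A;t) = Σ μ(X) (-t)^{codim X}` at `t : ℚ`. -/
def poincareEval (A : Finset (Submodule K (Fin ℓ → K))) (t : ℚ) : ℚ :=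
  ∑ X ∈ latticeOf ⊤ A,
    (mob (⊤ : Submodule K (Fin ℓ → K)) (latticeOf ⊤ A) X : ℚ) *
      (-t) ^ (ℓ - Module.finrank K X)

/-- The Euler derivation `θ_E = Σ xᵢ ∂/∂xᵢ`. -/
def eulerD : Deriv K ℓ := fun i => MvPolynomial.X i

/-- `A` is locally free: `A_X` is free for every `X ∈ L(A)` other than `∩_{H∈A} H`. -/
def LocallyFree (A : Finset (Submodule K (Fin ℓ → K))) : Prop :=
  ∀ X ∈ latticeOf ⊤ A, X ≠ A.inf id → IsFree (localize A X)

/-- Transport a finite set of subspaces contained in `T` to `K^m` along a linear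
isomorphism `T ≃ K^m`. -/
def transport {m : ℕ} (T : Submodule K (Fin ℓ → K)) (eqv : T ≃ₗ[K] (Fin m → K))
    (A : Finset (Submodule K (Fin ℓ → K))) : Finset (Submodule K (Fin m → K)) :=
  A.image fun L => (L.comap T.subtype).map eqv.toLinearMap

/-- An arrangement inside the subspace `T` is free with exponents `e`, i.e. it is free
after identifying `T` with a coordinate space. -/
def RestrFreeExp {m : ℕ} (T : Submodule K (Fin ℓ → K))
    (A : Finset (Submodule K (Fin ℓ → K))) (e : Fin m → ℕ) : Prop :=
  ∃ eqv : T ≃ₗ[K] (Fin m → K), IsFreeExp (transport T eqv A) e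

/-- The multiset of exponents. -/
def expMS {n : ℕ} (e : Fin n → ℕ) : Multiset ℕ := Finset.univ.val.map e

/-- `D(A)` has projective dimension at most 1: some finite generating set has a free
(possibly zero) syzygy module, i.e. there is a free resolution
`0 → S^m → S^n → D(A) → 0`. -/
def PdimLEOne (A : Finset (Submodule K (Fin ℓ → K))) : Prop :=
  ∃ (n m : ℕ) (θ : Fin n → Deriv K ℓ) (r : Fin m → Fin n → MvPolynomial (Fin ℓ) K),
    GeneratesD A θ ∧
    (∀ j, (∑ i, r j i • θ i) = 0) ∧
    (∀ c : Fin n → MvPolynomial (Fin ℓ) K, (∑ i, c i • θ i) = 0 →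
      ∃ q : Fin m → MvPolynomial (Fin ℓ) K, ∀ i, c i = ∑ j, q j * r j i) ∧
    (∀ q : Fin m → MvPolynomial (Fin ℓ) K, (∀ i, (∑ j, q j * r j i) = 0) → ∀ j, q j = 0)

/-- `A` has a free filtration `∅ = A₀ ⊂ A₁ ⊂ ⋯ ⊂ A_n = A`, `|A_i| = i`, each `A_i` free. -/
def HasFreeFiltration (A : Finset (Submodule K (Fin ℓ → K))) : Prop :=
  ∃ c : ℕ → Finset (Submodule K (Fin ℓ → K)),
    c A.card = A ∧ (∀ i ≤ A.card, (c i).card = i ∧ IsFree (c i)) ∧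
    ∀ i < A.card, c i ⊆ c (i + 1)

/-- The intersection lattices of `A` and `B` are isomorphic: there is a bijection of
hyperplanes preserving the rank of every subset (equivalently, a lattice isomorphism). -/
def LatticeEquiv (A B : Finset (Submodule K (Fin ℓ → K))) : Prop :=
  ∃ σ : Submodule K (Fin ℓ → K) → Submodule K (Fin ℓ → K),
    Set.BijOn σ ↑A ↑B ∧
    ∀ T ⊆ A, Module.finrank K ((T.inf id : Submodule K (Fin ℓ → K))) =
      Module.finrank K (((T.image σ).inf id : Submodule K (Fin ℓ → K)))


theorem dual_neg_smul (c : K) (a : Module.Dual K (Fin ℓ → K)) : (-c) • a = -(c • a) := by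
  apply LinearMap.ext
  intro x
  simp

theorem linPoly_add (a b : Module.Dual K (Fin ℓ → K)) :
    linPoly (a + b) = linPoly a + linPoly b := by
  simp [linPoly, add_mul, Finset.sum_add_distrib]

theorem linPoly_smul (c : K) (a : Module.Dual K (Fin ℓ → K)) :
    linPoly (c • a) = C c * linPoly a := by
  simp [linPoly, Finset.mul_sum, mul_assoc]

theorem applyLin_add (θ : Deriv K ℓ) (a b : Module.Dual K (Fin ℓ → K)) :
    applyLin θ (a + b) = applyLin θ a + applyLin θ b := by
  simp [applyLin, add_mul, Finset.sum_add_distrib]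

theorem applyLin_smul (θ : Deriv K ℓ) (c : K) (a : Module.Dual K (Fin ℓ → K)) :
    applyLin θ (c • a) = C c * applyLin θ a := by
  simp [applyLin, Finset.mul_sum, mul_assoc]

theorem applyLin_sub_smul (θ φ : Deriv K ℓ) (f : MvPolynomial (Fin ℓ) K)
    (a : Module.Dual K (Fin ℓ → K)) :
    applyLin (φ - f • θ) a = applyLin φ a - f * applyLin θ a := by
  simp only [applyLin, Pi.sub_apply, Pi.smul_apply, smul_eq_mul, mul_sub, Finset.sum_sub_distrib,
    Finset.mul_sum]
  congr 1
  exact Finset.sum_congr rfl fun i _ => by ring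

theorem dual_eq_zero_of (a : Module.Dual K (Fin ℓ → K)) (h : ∀ i, a (Pi.single i 1) = 0) :
    a = 0 := by
  apply LinearMap.pi_ext'
  intro i
  ext
  simpa using h i

theorem linPoly_eq_zero (a : Module.Dual K (Fin ℓ → K)) (h : linPoly a = 0) : a = 0 := by
  apply dual_eq_zero_of
  intro i
  have := congrArg (MvPolynomial.eval (Pi.single i (1 : K))) h
  simpa [linPoly, Pi.single_apply] using this

theorem linPoly_homog (a : Module.Dual K (Fin ℓ → K)) : (linPoly a).IsHomogeneous 1 := by
  apply IsHomogeneous.sum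
  intro i _
  exact (isHomogeneous_X K i).C_mul _

/-- elimination of the variable `j` modulo the linear form `a`. -/
def elim (a : Module.Dual K (Fin ℓ → K)) (j : Fin ℓ) :
    MvPolynomial (Fin ℓ) K →ₐ[K] MvPolynomial (Fin ℓ) K :=
  aeval (fun i => X i - C ((Pi.single j 1 : Fin ℓ → K) i * (a (Pi.single j 1))⁻¹) * linPoly a)

theorem elim_linPoly (a : Module.Dual K (Fin ℓ → K)) (j : Fin ℓ)
    (b : Module.Dual K (Fin ℓ → K)) :
    elim a j (linPoly b) =
      linPoly (b + (- (b (Pi.single j 1) * (a (Pi.single j 1))⁻¹)) • a) := by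
  rw [linPoly_add, linPoly_smul]
  conv_lhs => rw [linPoly]
  simp only [elim, map_sum, map_mul, aeval_X, algHom_C, mul_sub, Finset.sum_sub_distrib]
  rw [Finset.sum_eq_single (a := j) (f := fun x => _ * (_ * linPoly a))]
  · simp [linPoly, MvPolynomial.algebraMap_eq]; ring
  · intro i _ hi; simp [hi]
  · simp

theorem elim_self (a : Module.Dual K (Fin ℓ → K)) (j : Fin ℓ) (hj : a (Pi.single j 1) ≠ 0) :
    elim a j (linPoly a) = 0 := by
  rw [elim_linPoly, mul_inv_cancel₀ hj]
  simp [linPoly]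

theorem dvd_sub_elim (a : Module.Dual K (Fin ℓ → K)) (j : Fin ℓ) (p : MvPolynomial (Fin ℓ) K) :
    linPoly a ∣ p - elim a j p := by
  rw [← Ideal.mem_span_singleton, ← Ideal.Quotient.eq]
  have : (Ideal.Quotient.mkₐ K (Ideal.span {linPoly a})) =
      (Ideal.Quotient.mkₐ K (Ideal.span {linPoly a})).comp (elim a j) := by
    apply MvPolynomial.algHom_ext
    intro i
    simp only [AlgHom.comp_apply, Ideal.Quotient.mkₐ_eq_mk]
    rw [Ideal.Quotient.eq, Ideal.mem_span_singleton]
    simp [elim]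
  exact DFunLike.congr_fun this p

theorem dvd_iff_elim (a : Module.Dual K (Fin ℓ → K)) (j : Fin ℓ) (hj : a (Pi.single j 1) ≠ 0)
    (p : MvPolynomial (Fin ℓ) K) : linPoly a ∣ p ↔ elim a j p = 0 := by
  constructor
  · rintro ⟨q, rfl⟩
    rw [map_mul, elim_self a j hj, zero_mul]
  · intro h
    simpa [h] using dvd_sub_elim a j p

theorem exists_coord (a : Module.Dual K (Fin ℓ → K)) (ha : a ≠ 0) :
    ∃ j, a (Pi.single j 1) ≠ 0 := by
  by_contra! h
  exact ha (dual_eq_zero_of a h)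

theorem linPoly_prime (a : Module.Dual K (Fin ℓ → K)) (ha : a ≠ 0) : Prime (linPoly a) := by
  obtain ⟨j, hj⟩ := exists_coord a ha
  refine ⟨fun h => ha (linPoly_eq_zero a h), ?_, ?_⟩
  · intro h
    have := (dvd_iff_elim a j hj 1).1 h.dvd
    simp at this
  · intro p q h
    simpa [dvd_iff_elim a j hj] using h

theorem linPoly_relPrime (a b : Module.Dual K (Fin ℓ → K)) (ha : a ≠ 0) (hb : b ≠ 0)
    (hab : LinearMap.ker a ≠ LinearMap.ker b) : IsRelPrime (linPoly a) (linPoly b) := by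
  rw [(linPoly_prime a ha).irreducible.isRelPrime_iff_not_dvd]
  intro h
  obtain ⟨j, hj⟩ := exists_coord a ha
  rw [dvd_iff_elim a j hj, elim_linPoly] at h
  have h2 := linPoly_eq_zero _ h
  rw [dual_neg_smul, ← sub_eq_add_neg, sub_eq_zero] at h2
  apply hab
  rw [h2, LinearMap.ker_smul]
  intro h3
  rw [h3, zero_smul] at h2
  exact hb h2

theorem mem_span_two (a b c : Module.Dual K (Fin ℓ → K))
    (h : LinearMap.ker a ⊓ LinearMap.ker b ≤ LinearMap.ker c) :
    ∃ s t : K, c = s • a + t • b := by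
  have : c ∈ Submodule.span K (Set.range ![a, b]) := by
    apply mem_span_of_iInf_ker_le_ker
    intro x hx
    apply h
    rw [Submodule.mem_iInf] at hx
    exact ⟨hx 0, hx 1⟩
  rw [Matrix.range_cons, Matrix.range_cons, Matrix.range_empty, Set.union_empty,
    Set.singleton_union, Submodule.mem_span_pair] at this
  obtain ⟨s, t, h⟩ := this
  exact ⟨s, t, h.symm⟩

theorem exists_beta (A : Finset (Submodule K (Fin ℓ → K))) (hA : IsArrangement A)
    (a : Module.Dual K (Fin ℓ → K)) (ha : a ≠ 0)
    (j : Fin ℓ) (hj : a (Pi.single j 1) ≠ 0)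
    (Z : Submodule K (Fin ℓ → K)) (hZ : Z ∈ restrict A (LinearMap.ker a)) :
    ∃ β : Module.Dual K (Fin ℓ → K), β ≠ 0 ∧ β (Pi.single j 1) = 0 ∧
      LinearMap.ker β ⊓ LinearMap.ker a = Z ∧
      ∀ L ∈ A.erase (LinearMap.ker a), L ⊓ LinearMap.ker a = Z →
        ∃ e : K, LinearMap.ker (β + e • a) = L := by
  obtain ⟨L₀, hL₀, rfl⟩ := Finset.mem_image.1 hZ
  obtain ⟨hne, hmem⟩ := Finset.mem_erase.1 hL₀
  obtain ⟨g, hg0, rfl⟩ := hA _ hmem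
  set r := g (Pi.single j 1) * (a (Pi.single j 1))⁻¹ with hr
  have hβ0 : g - r • a ≠ 0 := by
    intro h
    rw [sub_eq_zero] at h
    apply hne
    rw [h, LinearMap.ker_smul]
    intro h3
    rw [h3, zero_smul] at h
    exact hg0 h
  have hβj : (g - r • a) (Pi.single j 1) = 0 := by
    simp [hr, hj]
  have hβk : LinearMap.ker (g - r • a) ⊓ LinearMap.ker a = LinearMap.ker g ⊓ LinearMap.ker a := by
    ext x
    simp only [Submodule.mem_inf, LinearMap.mem_ker, LinearMap.sub_apply, LinearMap.smul_apply]
    constructor <;> rintro ⟨h1, h2⟩ <;> simp_all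
  refine ⟨g - r • a, hβ0, hβj, hβk, ?_⟩
  intro L hL hLZ
  obtain ⟨hLne, hLA⟩ := Finset.mem_erase.1 hL
  obtain ⟨u, hu0, rfl⟩ := hA _ hLA
  obtain ⟨s, t, hst⟩ := mem_span_two u a (g - r • a) (by
    rw [hLZ, ← hβk]; exact inf_le_left)
  have hs : s ≠ 0 := by
    rintro rfl
    rw [zero_smul, zero_add] at hst
    rw [hst] at hβj hβ0
    have : t = 0 := by simpa [hj] using hβj
    simp [this] at hβ0
  refine ⟨-t, ?_⟩
  rw [hst, dual_neg_smul, add_neg_cancel_right, LinearMap.ker_smul _ _ hs]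

theorem pow_dvd_elim (A : Finset (Submodule K (Fin ℓ → K)))
    (a : Module.Dual K (Fin ℓ → K))
    (j : Fin ℓ) (hj : a (Pi.single j 1) ≠ 0)
    (β : Module.Dual K (Fin ℓ → K)) (hβ0 : β ≠ 0) (hβj : β (Pi.single j 1) = 0)
    (F : Finset (Submodule K (Fin ℓ → K))) (hF : F.Nonempty)
    (e : Submodule K (Fin ℓ → K) → K) (he : ∀ L ∈ F, LinearMap.ker (β + e L • a) = L)
    (φ : Deriv K ℓ) (hφ : InD F φ) :
    linPoly β ^ (F.card - 1) ∣ elim a j (applyLin φ a) := by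
  have hne : ∀ L, β + e L • a ≠ 0 := by
    intro L h
    have h2 := LinearMap.congr_fun h (Pi.single j 1)
    have h3 : e L = 0 := by simpa [hβj, hj] using h2
    rw [h3, zero_smul, add_zero] at h
    exact hβ0 h
  have hdvd : ∏ L ∈ F, linPoly (β + e L • a) ∣
      linPoly a * applyLin φ β - linPoly β * applyLin φ a := by
    apply Finset.prod_dvd_of_isRelPrime
    · intro L hL M hM hLM
      apply linPoly_relPrime _ _ (hne L) (hne M)
      rw [he L hL, he M hM]
      exact hLM
    · intro L hL
      have h := hφ L hL _ (he L hL)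
      have : linPoly a * applyLin φ β - linPoly β * applyLin φ a =
          linPoly a * applyLin φ (β + e L • a) - linPoly (β + e L • a) * applyLin φ a := by
        rw [linPoly_add, applyLin_add, linPoly_smul, applyLin_smul]; ring
      rw [this]
      exact dvd_sub (Dvd.dvd.mul_left h _) (dvd_mul_right _ _)
  have hel : ∀ c : K, elim a j (linPoly (β + c • a)) = linPoly β := by
    intro c
    rw [linPoly_add, map_add, linPoly_smul, map_mul, elim_self a j hj, mul_zero, add_zero,
      elim_linPoly, hβj]
    simp
  have h2 := map_dvd (elim a j) hdvd
  rw [map_prod, map_sub, map_mul, map_mul, elim_self a j hj] at h2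
  have hb := hel 0
  rw [zero_smul, add_zero] at hb
  simp only [hel, Finset.prod_const, hb, zero_mul, zero_sub, dvd_neg] at h2
  obtain ⟨n, hn⟩ : ∃ n, F.card = n + 1 := ⟨F.card - 1, by have := hF.card_pos; omega⟩
  rw [hn, pow_succ'] at h2
  rw [hn, Nat.add_sub_cancel]
  exact (mul_dvd_mul_iff_left (fun h => hβ0 (linPoly_eq_zero _ h))).1 h2

/-- Proposition `Bapply`: let `θ ∈ D(A')` be homogeneous of degree
`d = |A'| - |A^H|` with `θ ∉ D(A)`. Then every `φ ∈ D(A')` can be corrected into `D(A)`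
by an `S`-multiple of `θ`. -/
theorem correction_by_multiple {K : Type} [Field K] {ℓ : ℕ}
    (A : Finset (Submodule K (Fin ℓ → K)))
    (hA : IsArrangement A) (hEss : Essential A)
    (H : Submodule K (Fin ℓ → K)) (hH : H ∈ A)
    (d : ℕ) (hd : (d : ℤ) = ((A.erase H).card : ℤ) - ((restrict A H).card : ℤ))
    (θ : Deriv K ℓ) (hθ : InD (A.erase H) θ) (hhom : HomogDeriv θ d)
    (hnot : ¬ InD A θ) :
    ∀ φ : Deriv K ℓ, InD (A.erase H) φ →
      ∃ f : MvPolynomial (Fin ℓ) K, InD A (φ - f • θ) := by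
  intro φ hφ
  obtain ⟨a, ha, rfl⟩ := hA H hH
  obtain ⟨j, hj⟩ := exists_coord a ha
  have hex := exists_beta A hA a ha j hj
  choose! β hβ0 hβj hβk hβe using hex
  choose! e he using hβe
  set R := restrict A (LinearMap.ker a) with hR
  let F : Submodule K (Fin ℓ → K) → Finset (Submodule K (Fin ℓ → K)) :=
    fun Z => (A.erase (LinearMap.ker a)).filter (fun L => L ⊓ LinearMap.ker a = Z)
  have hFne : ∀ Z ∈ R, (F Z).Nonempty := by
    intro Z hZ
    obtain ⟨L, hL, h⟩ := Finset.mem_image.1 hZ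
    exact ⟨L, Finset.mem_filter.2 ⟨hL, h⟩⟩
  set B := ∏ Z ∈ R, linPoly (β Z) ^ ((F Z).card - 1) with hB
  have key : ∀ ψ : Deriv K ℓ, InD (A.erase (LinearMap.ker a)) ψ →
      B ∣ elim a j (applyLin ψ a) := by
    intro ψ hψ
    apply Finset.prod_dvd_of_isRelPrime
    · intro Z hZ W hW hZW
      apply IsRelPrime.pow
      apply linPoly_relPrime _ _ (hβ0 Z hZ) (hβ0 W hW)
      intro h
      apply hZW
      rw [← hβk Z hZ, ← hβk W hW, h]
    · intro Z hZ
      apply pow_dvd_elim A a j hj (β Z) (hβ0 Z hZ) (hβj Z hZ) (F Z) (hFne Z hZ) (e Z)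
      · intro L hL
        exact he Z hZ L (Finset.mem_filter.1 hL).1 (Finset.mem_filter.1 hL).2
      · intro L hL
        exact hψ L (Finset.mem_filter.1 hL).1
  have hBdeg : B.IsHomogeneous d := by
    have h1 : B.IsHomogeneous (∑ Z ∈ R, ((F Z).card - 1)) := by
      apply IsHomogeneous.prod
      intro Z _
      simpa using (linPoly_homog (β Z)).pow ((F Z).card - 1)
    have h2 : (A.erase (LinearMap.ker a)).card = ∑ Z ∈ R, (F Z).card :=
      Finset.card_eq_sum_card_image _ _
    have h3 : ∑ Z ∈ R, (F Z).card = ∑ Z ∈ R, ((F Z).card - 1) + R.card := by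
      rw [Finset.card_eq_sum_ones, ← Finset.sum_add_distrib]
      apply Finset.sum_congr rfl
      intro Z hZ
      have := (hFne Z hZ).card_pos
      omega
    have h4 : d = ∑ Z ∈ R, ((F Z).card - 1) := by omega
    rwa [h4]
  have hsuff : ∀ ψ : Deriv K ℓ, InD (A.erase (LinearMap.ker a)) ψ →
      linPoly a ∣ applyLin ψ a → InD A ψ := by
    intro ψ hψ h L hL b hb
    by_cases hLa : L = LinearMap.ker a
    · obtain ⟨s, t, hst⟩ := mem_span_two a a b (by rw [hb, hLa]; exact inf_le_left)
      rw [← add_smul] at hst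
      have hc : s + t ≠ 0 := by
        intro h0
        rw [h0, zero_smul] at hst
        apply ha
        rw [hst, hLa, LinearMap.ker_zero] at hb
        exact LinearMap.ker_eq_top.1 hb.symm
      rw [hst, linPoly_smul, applyLin_smul]
      exact mul_dvd_mul_left _ h
    · exact hψ L (Finset.mem_erase.2 ⟨hLa, hL⟩) b hb
  have hθ0 : elim a j (applyLin θ a) ≠ 0 := by
    intro h
    exact hnot (hsuff θ hθ ((dvd_iff_elim a j hj _).2 h))
  have hθhom : (elim a j (applyLin θ a)).IsHomogeneous d := by
    have h1 : (applyLin θ a).IsHomogeneous d := by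
      apply IsHomogeneous.sum
      intro i _
      exact (hhom i).C_mul _
    have := h1.aeval (fun i => X i -
      C ((Pi.single j 1 : Fin ℓ → K) i * (a (Pi.single j 1))⁻¹) * linPoly a) (n := 1)
      (fun i => (isHomogeneous_X K i).sub ((linPoly_homog a).C_mul _))
    rwa [one_mul] at this
  obtain ⟨c, hc⟩ := key θ hθ
  obtain ⟨q, hq⟩ := key φ hφ
  have hB0 : B ≠ 0 := by rintro h; rw [h, zero_mul] at hc; exact hθ0 hc
  have hc0 : c ≠ 0 := by rintro h; rw [h, mul_zero] at hc; exact hθ0 hc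
  have hcdeg : c.totalDegree = 0 := by
    have h1 := hθhom.totalDegree hθ0
    rw [hc, totalDegree_mul_of_isDomain hB0 hc0, hBdeg.totalDegree hB0] at h1
    omega
  rw [totalDegree_eq_zero_iff_eq_C] at hcdeg
  set k := coeff 0 c with hk
  have hk0 : k ≠ 0 := by rintro h; rw [h, C_0] at hcdeg; exact hc0 hcdeg
  have hkk : (C k⁻¹ * C k : MvPolynomial (Fin ℓ) K) = 1 := by
    rw [← C_mul, inv_mul_cancel₀ hk0, C_1]
  refine ⟨q * C k⁻¹, ?_⟩
  apply hsuff
  · intro L hL b hb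
    rw [applyLin_sub_smul]
    exact dvd_sub (hφ L hL b hb) (Dvd.dvd.mul_left (hθ L hL b hb) _)
  · rw [applyLin_sub_smul]
    have h1 := dvd_sub_elim a j (applyLin φ a)
    have h2 := dvd_sub_elim a j (applyLin θ a)
    rw [hq] at h1
    rw [hc, hcdeg] at h2
    have h3 := dvd_sub h1 (Dvd.dvd.mul_left h2 (q * C k⁻¹))
    convert h3 using 1
    linear_combination (-(B * q)) * hkk

end ArrPOG
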